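/- arXiv:math/0701409 — 2 statements merged into one kernel-verified Lean document; each statement's English description precedes it below -/
import Mathlib

section
/- Let X be a union of k double points in P^n and H a hyperplane containing u of the supporting points. Suppose the trace X ∩ H imposes independent conditions on O_H(d), the residual scheme imposes independent conditions on O(d−1), and either (i) un ≤ C(d+n−1, n−1) and k(n+1) − un ≤ C(d+n−1, n), or (ii) both reversed inequalities hold. Then X imposes independent conditions on O(d). -/
open MvPolynomial

noncomputable section

/-- The linear functional `h ↦ (∂h/∂xᵢ)(q)` on polynomials. -/
def derivCond {K : Type*} [Field K] {N : ℕ} (q : Fin N → K) (i : Fin N) :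
    MvPolynomial (Fin N) K →ₗ[K] K :=
  (aeval q).toLinearMap ∘ₗ (pderiv i).toLinearMap

/-- The space of polynomials all of whose first partial derivatives vanish at `q`
(i.e. hypersurfaces singular at `q`, containing the double point `q²`). -/
def singularAt {K : Type*} [Field K] {N : ℕ} (q : Fin N → K) :
    Submodule K (MvPolynomial (Fin N) K) :=
  ⨅ i, LinearMap.ker (derivCond q i)

/-- The directional derivative at `q` in direction `g`: `h ↦ Σⱼ gⱼ (∂h/∂xⱼ)(q)`. -/
def dirDerivCond {K : Type*} [Field K] {N : ℕ} (q g : Fin N → K) :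
    MvPolynomial (Fin N) K →ₗ[K] K :=
  ∑ j, g j • derivCond q j

/-- The codimension of `S ⊓ W` inside the subspace `W`. -/
def codimIn {K : Type*} [Field K] {N : ℕ} (W S : Submodule K (MvPolynomial (Fin N) K)) : ℕ :=
  Module.finrank K (↥W ⧸ Submodule.comap W.subtype S)

/-- The space of degree-`d` forms in `N` variables has dimension `C(N + d - 1, d)`. -/
theorem finrank_homogeneousSubmodule (K : Type*) [Field K] (N d : ℕ) :
    Module.finrank K (homogeneousSubmodule (Fin N) K d) = (N + d - 1).choose d := by
  rw [homogeneousSubmodule_eq_finsupp_supported,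
    Module.finrank_eq_nat_card_basis
      (Module.Basis.ofRepr (AddMonoidAlgebra.supportedEquivFinsupp (R := K) (S := K)
        {m : Fin N →₀ ℕ | m.degree = d}))]
  have e : Sym (Fin N) d ≃ {m : Fin N →₀ ℕ | m.degree = d} := Sym.equivNatSum (Fin N) d
  rw [← Nat.card_congr e, Sym.natCard_sym_eq_choose, Nat.card_fin]

instance finite_homogeneousSubmodule (K : Type*) [Field K] (N d : ℕ) :
    Module.Finite K (homogeneousSubmodule (Fin N) K d) :=
  Module.Finite.iff_fg.mpr (homogeneousSubmodule_fg (Fin N) K d)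

theorem codimIn_le_finrank {K : Type*} [Field K] {N : ℕ}
    (W S : Submodule K (MvPolynomial (Fin N) K)) [Module.Finite K W] :
    codimIn W S ≤ Module.finrank K W :=
  Submodule.finrank_quotient_le _

/-- A subspace cut out by finitely many linear conditions has codimension at most the number
of conditions. -/
theorem codimIn_iInf_ker_le_card {K ι : Type*} [Field K] [Fintype ι] {N : ℕ}
    (W : Submodule K (MvPolynomial (Fin N) K)) (f : ι → MvPolynomial (Fin N) K →ₗ[K] K) :
    codimIn W (⨅ i, LinearMap.ker (f i)) ≤ Fintype.card ι := by
  have hker : Submodule.comap W.subtype (⨅ i, LinearMap.ker (f i)) =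
      LinearMap.ker (LinearMap.pi f ∘ₗ W.subtype) := by
    rw [LinearMap.ker_comp, LinearMap.ker_pi]
  rw [codimIn, hker, (LinearMap.quotKerEquivRange _).finrank_eq]
  exact (Submodule.finrank_le _).trans_eq (Module.finrank_fintype_fun_eq_card K)

/-- The dimension count of the Castelnuovo exact sequence: a subspace `A` of `T` has codimension
at least that of `T` plus that of any subspace containing the preimage of `A` under a linear map
with values in `T`. -/
theorem finrank_quotient_add_finrank_quotient_le {K V V' : Type*} [Field K]
    [AddCommGroup V] [Module K V] [Module.Finite K V] [AddCommGroup V'] [Module K V']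
    (A T : Submodule K V) (R : Submodule K V') (f : V' →ₗ[K] V) (hAT : A ≤ T)
    (hf : ∀ x, f x ∈ T) (hR : A.comap f ≤ R) :
    Module.finrank K (V ⧸ T) + Module.finrank K (V' ⧸ R) ≤ Module.finrank K (V ⧸ A) := by
  let g : (V' ⧸ A.comap f) →ₗ[K] V ⧸ A := Submodule.mapQ _ _ f le_rfl
  have hg : Function.Injective g := by
    rw [← LinearMap.ker_eq_bot]
    exact Submodule.ker_liftQ_eq_bot _ _ _ (by rw [LinearMap.ker_comp, Submodule.ker_mkQ])
  have : Module.Finite K (V' ⧸ A.comap f) := Module.Finite.of_injective g hg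
  have hsurj : Function.Surjective (Submodule.factor hR) := Submodule.factor_surjective hR
  have hle : LinearMap.range g ≤ LinearMap.ker (Submodule.factor hAT) := by
    rintro _ ⟨x, rfl⟩
    obtain ⟨x, rfl⟩ := Submodule.Quotient.mk_surjective _ x
    simpa [g] using hf x
  calc Module.finrank K (V ⧸ T) + Module.finrank K (V' ⧸ R)
      ≤ Module.finrank K (V ⧸ T) + Module.finrank K (V' ⧸ A.comap f) :=
        Nat.add_le_add_left (LinearMap.finrank_le_finrank_of_surjective hsurj) _
    _ = Module.finrank K (V ⧸ T) + Module.finrank K (LinearMap.range g) := by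
        rw [LinearMap.finrank_range_of_inj hg]
    _ ≤ Module.finrank K (V ⧸ T) + Module.finrank K (LinearMap.ker (Submodule.factor hAT)) :=
        Nat.add_le_add_left (Submodule.finrank_mono hle) _
    _ = Module.finrank K (V ⧸ A) := by
        rw [← LinearMap.finrank_range_add_finrank_ker (Submodule.factor hAT),
          LinearMap.range_eq_top.mpr (Submodule.factor_surjective hAT), finrank_top]

/-- The linear form with the same values as the functional `ℓ`. -/
def linearFormPoly {K : Type*} [Field K] {N : ℕ} (ℓ : (Fin N → K) →ₗ[K] K) :
    MvPolynomial (Fin N) K :=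
  ∑ j, C (ℓ (Pi.single j 1)) * X j

theorem isHomogeneous_linearFormPoly {K : Type*} [Field K] {N : ℕ} (ℓ : (Fin N → K) →ₗ[K] K) :
    (linearFormPoly ℓ).IsHomogeneous 1 :=
  IsHomogeneous.sum _ _ _ fun j _ => isHomogeneous_C_mul_X _ j

theorem sum_mul_apply_single {K : Type*} [Field K] {N : ℕ} (ℓ : (Fin N → K) →ₗ[K] K)
    (q : Fin N → K) : ∑ j, q j * ℓ (Pi.single j 1) = ℓ q := by
  conv_rhs => rw [pi_eq_sum_univ' q, map_sum]
  exact Finset.sum_congr rfl fun j _ => by rw [map_smul, smul_eq_mul]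

theorem aeval_linearFormPoly {K : Type*} [Field K] {N : ℕ} (ℓ : (Fin N → K) →ₗ[K] K)
    (q : Fin N → K) : aeval q (linearFormPoly ℓ) = ℓ q := by
  rw [← sum_mul_apply_single ℓ q]
  simp [linearFormPoly, mul_comm]

theorem derivCond_linearFormPoly_mul {K : Type*} [Field K] {N : ℕ} (ℓ : (Fin N → K) →ₗ[K] K)
    (q : Fin N → K) (i : Fin N) (h : MvPolynomial (Fin N) K) :
    derivCond q i (linearFormPoly ℓ * h) =
      ℓ (Pi.single i 1) * aeval q h + ℓ q * derivCond q i h := by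
  have hpd : pderiv i (linearFormPoly ℓ) = C (ℓ (Pi.single i 1)) := by
    simp [linearFormPoly, pderiv_X, Pi.single_apply]
  simp only [derivCond, LinearMap.comp_apply, AlgHom.toLinearMap_apply, Derivation.coeFn_coe,
    Derivation.leibniz, hpd, smul_eq_mul, map_add, map_mul, aeval_linearFormPoly, aeval_C,
    Algebra.algebraMap_self, RingHom.id_apply]
  ring

theorem mem_singularAt {K : Type*} [Field K] {N : ℕ} {q : Fin N → K}
    {h : MvPolynomial (Fin N) K} : h ∈ singularAt q ↔ ∀ i, derivCond q i h = 0 := by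
  simp [singularAt]

/-- Euler's identity evaluated at a point. -/
theorem sum_mul_derivCond {K : Type*} [Field K] {N m : ℕ} (q : Fin N → K)
    {h : MvPolynomial (Fin N) K} (hh : h.IsHomogeneous m) :
    ∑ i, q i * derivCond q i h = m * aeval q h := by
  simpa [derivCond] using congrArg (aeval q) hh.sum_X_mul_pderiv

/-- If `ℓ * h` is singular at a point of the hyperplane `ℓ = 0`, then `h` vanishes there. -/
theorem aeval_eq_zero_of_linearFormPoly_mul_mem_singularAt {K : Type*} [Field K] {N : ℕ}
    {ℓ : (Fin N → K) →ₗ[K] K} (hℓ : ℓ ≠ 0) {q : Fin N → K} (hq : ℓ q = 0)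
    {h : MvPolynomial (Fin N) K} (hs : linearFormPoly ℓ * h ∈ singularAt q) :
    aeval q h = 0 := by
  by_contra hne
  refine hℓ (LinearMap.ext fun v => ?_)
  rw [← sum_mul_apply_single ℓ v]
  refine Finset.sum_eq_zero fun j _ => ?_
  have := mem_singularAt.mp hs j
  rw [derivCond_linearFormPoly_mul, hq, zero_mul, add_zero] at this
  rw [(mul_eq_zero.mp this).resolve_right hne, mul_zero]

/-- If `ℓ * h` is singular at a point off the hyperplane `ℓ = 0`, then so is the form `h`. -/
theorem mem_singularAt_of_linearFormPoly_mul_mem_singularAt {K : Type*} [Field K] [CharZero K]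
    {N m : ℕ} {ℓ : (Fin N → K) →ₗ[K] K} {q : Fin N → K} (hq : ℓ q ≠ 0)
    {h : MvPolynomial (Fin N) K} (hh : h.IsHomogeneous m)
    (hs : linearFormPoly ℓ * h ∈ singularAt q) : h ∈ singularAt q := by
  have h0 := mem_singularAt.mp hs
  have hval : aeval q h = 0 := by
    have := sum_mul_derivCond q ((isHomogeneous_linearFormPoly ℓ).mul hh)
    simp only [h0, mul_zero, Finset.sum_const_zero, map_mul, aeval_linearFormPoly] at this
    have hm : ((1 + m : ℕ) : K) ≠ 0 := by
      rw [Nat.cast_ne_zero]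
      omega
    exact (mul_eq_zero.mp ((mul_eq_zero.mp this.symm).resolve_left hm)).resolve_left hq
  refine mem_singularAt.mpr fun i => ?_
  have := h0 i
  rw [derivCond_linearFormPoly_mul, hval, mul_zero, zero_add] at this
  exact (mul_eq_zero.mp this).resolve_left hq

theorem dirDerivCond_apply {K : Type*} [Field K] {N : ℕ} (q g : Fin N → K)
    (h : MvPolynomial (Fin N) K) : dirDerivCond q g h = ∑ j, g j * derivCond q j h := by
  simp [dirDerivCond]

theorem dirDerivCond_linearFormPoly_mul {K : Type*} [Field K] {N : ℕ}
    {ℓ : (Fin N → K) →ₗ[K] K} {q g : Fin N → K} (hq : ℓ q = 0) (hg : ℓ g = 0)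
    (h : MvPolynomial (Fin N) K) : dirDerivCond q g (linearFormPoly ℓ * h) = 0 := by
  simp only [dirDerivCond_apply, derivCond_linearFormPoly_mul, hq, zero_mul, add_zero, ← mul_assoc]
  rw [← Finset.sum_mul, sum_mul_apply_single, hg, zero_mul]

/-- Multiplication by the linear form `ℓ` from forms of degree `m` to forms of degree `d`. -/
def mulLinearForm {K : Type*} [Field K] {N : ℕ} (ℓ : (Fin N → K) →ₗ[K] K) {m d : ℕ}
    (hmd : 1 + m = d) :
    homogeneousSubmodule (Fin N) K m →ₗ[K] homogeneousSubmodule (Fin N) K d :=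
  (LinearMap.mulLeft K (linearFormPoly ℓ)).restrict fun _ hh =>
    hmd ▸ (isHomogeneous_linearFormPoly ℓ).mul hh

/-- Horace's lemma (Theorem 4.1 of Brambilla–Ottaviani).  Let `X` be a union of `k`
double points of `P^n` supported at the (projectively distinct, nonzero) points
`p 0, …, p (k-1)`, and let `H` be the hyperplane defined by the nonzero linear form `ℓ`,
containing exactly the first `u` of the points.  Assume that the trace `X ∩ H` imposes
independent conditions on `O_H(d)` (degree-`d` forms on `H`), that the residual scheme
(the `k−u` double points off `H` together with the `u` simple points on `H`) imposes
independent conditions on `O(d−1)`, and that one of the numerical conditions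
(i) `un ≤ C(d+n−1,n−1)` and `k(n+1) − un ≤ C(d+n−1,n)`, or
(ii) the two reversed inequalities, holds.  Then `X` imposes independent conditions on
`O(d)`: the space of degree-`d` forms singular at all the points has codimension
`min(k(n+1), C(d+n,n))`. -/
theorem stmt_17 (K : Type*) [Field K] [CharZero K] (n d k u : ℕ) (hd : 1 ≤ d) (hu : u ≤ k)
    (ℓ : (Fin (n + 1) → K) →ₗ[K] K) (hℓ : ℓ ≠ 0)
    (p : Fin k → (Fin (n + 1) → K)) (hp0 : ∀ i, p i ≠ 0)
    (hdist : ∀ i j, i ≠ j → ∀ c : K, p j ≠ c • p i)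
    (honH : ∀ i : Fin k, (i : ℕ) < u → ℓ (p i) = 0)
    (hoffH : ∀ i : Fin k, u ≤ (i : ℕ) → ℓ (p i) ≠ 0)
    -- the trace `X ∩ H` imposes independent conditions on `O_H(d)`
    (htrace : codimIn (homogeneousSubmodule (Fin (n + 1)) K d)
        (⨅ i : Fin k, ⨅ _ : (i : ℕ) < u, ⨅ g ∈ LinearMap.ker ℓ,
          LinearMap.ker (dirDerivCond (p i) g)) =
        min (u * n) ((d + n - 1).choose (n - 1)))
    -- the residual scheme imposes independent conditions on `O(d−1)`
    (hres : codimIn (homogeneousSubmodule (Fin (n + 1)) K (d - 1))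
        ((⨅ i : Fin k, ⨅ _ : u ≤ (i : ℕ), singularAt (p i)) ⊓
          (⨅ i : Fin k, ⨅ _ : (i : ℕ) < u, LinearMap.ker (aeval (p i)).toLinearMap)) =
        min ((k - u) * (n + 1) + u) ((d - 1 + n).choose n))
    (hnum : ((u * n : ℤ) ≤ ((d + n - 1).choose (n - 1) : ℤ) ∧
              (k : ℤ) * (n + 1) - u * n ≤ ((d + n - 1).choose n : ℤ)) ∨
            (((d + n - 1).choose (n - 1) : ℤ) ≤ (u * n : ℤ) ∧
              ((d + n - 1).choose n : ℤ) ≤ (k : ℤ) * (n + 1) - u * n)) :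
    codimIn (homogeneousSubmodule (Fin (n + 1)) K d) (⨅ i, singularAt (p i)) =
      min (k * (n + 1)) ((d + n).choose n) := by
  set R := (⨅ i : Fin k, ⨅ _ : u ≤ (i : ℕ), singularAt (p i)) ⊓
    (⨅ i : Fin k, ⨅ _ : (i : ℕ) < u, LinearMap.ker (aeval (R := K) (p i)).toLinearMap) with hRdef
  set T := ⨅ i : Fin k, ⨅ _ : (i : ℕ) < u, ⨅ g ∈ LinearMap.ker ℓ,
    LinearMap.ker (dirDerivCond (p i) g) with hTdef
  set A := ⨅ i, singularAt (p i) with hAdef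
  have hlower : codimIn (homogeneousSubmodule (Fin (n + 1)) K d) T +
      codimIn (homogeneousSubmodule (Fin (n + 1)) K (d - 1)) R ≤
        codimIn (homogeneousSubmodule (Fin (n + 1)) K d) A := by
    refine finrank_quotient_add_finrank_quotient_le _ _ _ (mulLinearForm ℓ (by omega))
      (Submodule.comap_mono ?_) ?_ ?_
    · intro f hf
      simp only [hAdef, hTdef, Submodule.mem_iInf, LinearMap.mem_ker] at hf ⊢
      intro i _ g _
      simp [dirDerivCond_apply, mem_singularAt.mp (hf i)]
    · rintro ⟨h, _⟩
      simp only [hTdef, Submodule.mem_comap, Submodule.mem_iInf, LinearMap.mem_ker]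
      exact fun i hi g hg => dirDerivCond_linearFormPoly_mul (honH i hi) hg h
    · rintro ⟨h, hh⟩ hs
      have hs' : ∀ i, linearFormPoly ℓ * h ∈ singularAt (p i) := by
        simpa only [hAdef, Submodule.mem_comap, Submodule.mem_iInf] using! hs
      simp only [hRdef, Submodule.mem_comap, Submodule.mem_inf, Submodule.mem_iInf,
        LinearMap.mem_ker]
      exact ⟨fun i hi =>
          mem_singularAt_of_linearFormPoly_mul_mem_singularAt (hoffH i hi) hh (hs' i),
        fun i hi => aeval_eq_zero_of_linearFormPoly_mul_mem_singularAt hℓ (honH i hi) (hs' i)⟩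
  have hupper₁ : codimIn (homogeneousSubmodule (Fin (n + 1)) K d) A ≤ k * (n + 1) := by
    have hA : A = ⨅ x : Fin k × Fin (n + 1), LinearMap.ker (derivCond (p x.1) x.2) := by
      rw [iInf_prod]
      rfl
    simpa [hA] using codimIn_iInf_ker_le_card (homogeneousSubmodule (Fin (n + 1)) K d)
      fun x : Fin k × Fin (n + 1) => derivCond (p x.1) x.2
  have hupper₂ : codimIn (homogeneousSubmodule (Fin (n + 1)) K d) A ≤ (d + n).choose n := by
    refine (codimIn_le_finrank _ _).trans_eq ?_
    rw [finrank_homogeneousSubmodule, show n + 1 + d - 1 = d + n by omega, Nat.choose_symm_add]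
  rw [htrace, hres] at hlower
  refine le_antisymm (le_min hupper₁ hupper₂) (le_trans ?_ hlower)
  obtain ⟨v, rfl⟩ := Nat.exists_eq_add_of_le hu
  have hsum : (u + v) * (n + 1) = u * n + (v * (n + 1) + u) := by ring
  have hsumZ : ((u + v : ℕ) : ℤ) * (n + 1) - u * n = ((v * (n + 1) + u : ℕ) : ℤ) := by
    push_cast
    ring
  rw [hsumZ] at hnum
  rw [Nat.add_sub_cancel_left, show d - 1 + n = d + n - 1 by omega, hsum]
  rcases hnum with ⟨h₁, h₂⟩ | ⟨h₁, h₂⟩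
  · refine (min_le_left _ _).trans ?_
    rw [min_eq_left (by exact_mod_cast h₁), min_eq_left (by exact_mod_cast h₂)]
  · refine (min_le_right _ _).trans ?_
    rw [min_eq_right (by exact_mod_cast h₁), min_eq_right (by exact_mod_cast h₂)]
    obtain _ | n := n
    · simp
    · rw [show d + (n + 1) - 1 = d + n by omega, ← add_assoc, Nat.choose_succ_succ,
        Nat.add_sub_cancel]

end
end

section
/- A general union of k double points in P^2 imposes independent conditions on plane curves of degree d (i.e., the forms of degree d singular at the k points form a space of codimension min(3k, C(d+2,2))), except exactly when (d,k) = (2,2) or (d,k) = (4,5). -/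
open MvPolynomial

noncomputable section

section DoublePoints

open Finset

/-- The values at the exponent `(a, r)` of the operators `1`, `x∂/∂x`, `y∂/∂y` on
`x ^ a * y ^ r`. -/
def jet (K : Type*) [Field K] (α : ℕ × ℕ) : Fin 3 → K := ![1, α.1, α.2]

/-- There are `k` points of the torus, with distinct first coordinates, such that no nonzero
polynomial with exponents in `S` is singular at all of them. -/
def Interpolates (K : Type*) [Field K] (S : Finset (ℕ × ℕ)) (k : ℕ) : Prop :=
  ∃ u v : Fin k → K, Function.Injective u ∧ (∀ i, u i ≠ 0) ∧ (∀ i, v i ≠ 0) ∧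
    ∀ c : ℕ × ℕ → K, (∀ i j, ∑ α ∈ S, c α * (u i ^ α.1 * v i ^ α.2 * jet K α j) = 0) →
      ∀ α ∈ S, c α = 0

section Interpolates

variable {K : Type*} [Field K] {S : Finset (ℕ × ℕ)} {k : ℕ}

theorem Interpolates.mono {S' : Finset (ℕ × ℕ)} (h : Interpolates K S k) (hS : S' ⊆ S) :
    Interpolates K S' k := by
  obtain ⟨u, v, hu, hu0, hv0, H⟩ := h
  refine ⟨u, v, hu, hu0, hv0, fun c hc α hα => ?_⟩
  have := H (fun β => if β ∈ S' then c β else 0) (fun i j => ?_) α (hS hα)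
  · simpa [hα] using this
  · refine Eq.trans (Eq.symm (Finset.sum_subset hS fun β _ hβ => ?_)) (Eq.trans ?_ (hc i j))
    · simp only [if_neg hβ, zero_mul]
    · exact Finset.sum_congr rfl fun β hβ => by rw [if_pos hβ]

/-- Points outside the zero set of a nonzero polynomial, on the torus, with new first coordinate. -/
theorem exists_torus_eval_ne_zero [Infinite K] (u : Fin k → K) {P : MvPolynomial (Fin 2) K}
    (hP : P ≠ 0) : ∃ x y : K, x ≠ 0 ∧ y ≠ 0 ∧ (∀ i, x ≠ u i) ∧ eval ![x, y] P ≠ 0 := by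
  have hX : ∀ i, (X 0 - C (u i) : MvPolynomial (Fin 2) K) ≠ 0 := fun i h => by
    have := congrArg (eval ![u i + 1, 0]) h
    simp at this
  have hQ : P * X 0 * X 1 * ∏ i, (X 0 - C (u i)) ≠ 0 :=
    mul_ne_zero (mul_ne_zero (mul_ne_zero hP (X_ne_zero _)) (X_ne_zero _))
      (Finset.prod_ne_zero_iff.mpr fun i _ => hX i)
  obtain ⟨x, hx⟩ : ∃ x, eval x (P * X 0 * X 1 * ∏ i, (X 0 - C (u i))) ≠ 0 := by
    by_contra! h
    exact hQ (MvPolynomial.funext fun x => by rw [h x, map_zero])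
  have hxe : x = ![x 0, x 1] := by ext i; fin_cases i <;> rfl
  simp only [map_mul, map_prod, map_sub, eval_X, eval_C, mul_ne_zero_iff,
    Finset.prod_ne_zero_iff] at hx
  exact ⟨x 0, x 1, hx.1.1.2, hx.1.2, fun i => sub_ne_zero.mp (hx.2 i (mem_univ i)),
    hxe ▸ hx.1.1.1⟩

theorem Interpolates.succ [Infinite K] (h : Interpolates K S k) : Interpolates K S (k + 1) := by
  obtain ⟨u, v, hu, hu0, hv0, H⟩ := h
  obtain ⟨x, y, hx, hy, hxu, -⟩ :=
    exists_torus_eval_ne_zero u (one_ne_zero (α := MvPolynomial (Fin 2) K))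
  refine ⟨Fin.cons x u, Fin.cons y v, ?_, Fin.cases hx hu0, Fin.cases hy hv0, fun c hc => ?_⟩
  · exact Fin.cons_injective_iff.mpr ⟨fun ⟨i, hi⟩ => hxu i hi.symm, hu⟩
  · exact H c fun i j => by simpa using hc i.succ j

theorem Interpolates.mono_right [Infinite K] (h : Interpolates K S k) {k' : ℕ} (hk : k ≤ k') :
    Interpolates K S k' := by
  induction hk with
  | refl => exact h
  | step _ ih => exact ih.succ

theorem Interpolates.empty_zero : Interpolates K ∅ 0 :=
  ⟨Fin.elim0, Fin.elim0, fun i => i.elim0, fun i => i.elim0, fun i => i.elim0,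
    fun _ _ _ h => by simp at h⟩

/-- The determinant of the jets of three polynomials with exponents in `S` is the sum, over the
triples of exponents, of the products of coefficients times the determinants of the triples. -/
theorem coeff_det_jets (S : Finset (ℕ × ℕ)) (h : Fin 3 → ℕ × ℕ → K) (m : Fin 2 →₀ ℕ) :
    coeff m (Matrix.det (Matrix.of fun i j => ∑ α ∈ S,
      (monomial (Finsupp.equivFunOnFinite.symm ![α.1, α.2]) (h i α) * C (jet K α j) :
        MvPolynomial (Fin 2) K))) =
    ∑ σ ∈ Fintype.piFinset fun _ : Fin 3 => S,
      if ∑ i, Finsupp.equivFunOnFinite.symm ![(σ i).1, (σ i).2] = m then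
        (∏ i, h i (σ i)) * Matrix.det (Matrix.of fun i => jet K (σ i)) else 0 := by
  have h1 : (fun i j => ∑ α ∈ S, (monomial (Finsupp.equivFunOnFinite.symm ![α.1, α.2])
      (h i α) * C (jet K α j) : MvPolynomial (Fin 2) K)) =
      fun i : Fin 3 => ∑ α ∈ S, (monomial (Finsupp.equivFunOnFinite.symm ![α.1, α.2]) (h i α) :
        MvPolynomial (Fin 2) K) • fun j => C (jet K α j) := by
    ext1 i; ext1 j
    simp [Finset.sum_apply]
  rw [h1]
  change coeff m (Matrix.detRowAlternating.toMultilinearMap fun i : Fin 3 => ∑ α ∈ S, _) = _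
  rw [MultilinearMap.map_sum_finset, coeff_sum]
  refine Finset.sum_congr rfl fun σ _ => ?_
  rw [MultilinearMap.map_smul_univ]
  have h2 : (Matrix.detRowAlternating.toMultilinearMap
      fun i : Fin 3 => fun j => (C (jet K (σ i) j) : MvPolynomial (Fin 2) K)) =
      C (Matrix.det (Matrix.of fun i => jet K (σ i))) := by
    rw [RingHom.map_det]
    rfl
  rw [h2, smul_eq_mul, mul_comm, coeff_C_mul, ← monomial_sum_prod, coeff_monomial, mul_ite,
    mul_zero, mul_comm]

/-- If the points of `Interpolates K S k` are kept, the exponents of a non-collinear triple `τ` can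
be added at the cost of one more point, provided that no other triple meeting `S` has the same
sum as `τ`. -/
theorem Interpolates.union_triple [Infinite K] (h : Interpolates K S k) (τ : Fin 3 → ℕ × ℕ)
    (hτS : ∀ i, τ i ∉ S) (hdet : Matrix.det (Matrix.of fun i => jet K (τ i)) ≠ 0)
    (huniq : ∀ σ : Fin 3 → ℕ × ℕ, Function.Injective σ → (∀ i, σ i ∈ S ∪ univ.image τ) →
      ∑ i, σ i = ∑ i, τ i → ∀ i, σ i ∉ S) :
    Interpolates K (S ∪ univ.image τ) (k + 1) := by
  obtain ⟨u, v, hu, hu0, hv0, H⟩ := h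
  set S' := S ∪ univ.image τ with hS'
  have inj_of_det : ∀ σ : Fin 3 → ℕ × ℕ, Matrix.det (Matrix.of fun i => jet K (σ i)) ≠ 0 →
      Function.Injective σ := fun σ hσ i j hij => by
    by_contra hne
    exact hσ (Matrix.det_zero_of_row_eq hne (congrArg (jet K) hij))
  have hτ := inj_of_det τ hdet
  let W : Submodule K (ℕ × ℕ → K) :=
    { carrier := {c | (∀ α ∉ S', c α = 0) ∧
        ∀ i j, ∑ α ∈ S', c α * (u i ^ α.1 * v i ^ α.2 * jet K α j) = 0}
      add_mem' := fun {a b} ha hb => ⟨fun α hα => by simp [ha.1 α hα, hb.1 α hα], fun i j => by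
        simp [add_mul, Finset.sum_add_distrib, ha.2 i j, hb.2 i j]⟩
      zero_mem' := ⟨fun _ _ => rfl, fun i j => by simp⟩
      smul_mem' := fun r a ha => ⟨fun α hα => by simp [ha.1 α hα], fun i j => by
        simp [mul_assoc, ← Finset.mul_sum]
        right
        simpa [mul_assoc] using ha.2 i j⟩ }
  have eq_zero : ∀ c ∈ W, (∀ i, c (τ i) = 0) → c = 0 := by
    intro c hc hcτ
    have hS : ∀ α ∈ S, c α = 0 := H c fun i j => by
      refine Eq.trans (Finset.sum_subset subset_union_left fun α hα hαS => ?_) (hc.2 i j)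
      obtain ⟨l, -, rfl⟩ := Finset.mem_image.mp ((Finset.mem_union.mp hα).resolve_left hαS)
      rw [hcτ, zero_mul]
    ext α
    by_cases hα : α ∈ S'
    · rcases Finset.mem_union.mp hα with hα | hα
      · exact hS α hα
      · obtain ⟨l, -, rfl⟩ := Finset.mem_image.mp hα
        exact hcτ l
    · exact hc.1 α hα
  let ρ : W →ₗ[K] (Fin 3 → K) := LinearMap.pi fun i => LinearMap.proj (τ i) ∘ₗ W.subtype
  obtain ⟨L, hL⟩ := ρ.exists_leftInverse_of_injective (LinearMap.ker_eq_bot'.mpr fun w hw =>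
    Subtype.ext (eq_zero w w.2 fun i => congrFun hw i))
  let g : Fin 3 → ℕ × ℕ → K := fun i α =>
    if α ∈ S then (L (Pi.single i 1) : ℕ × ℕ → K) α else if α = τ i then 1 else 0
  have hg : ∀ w ∈ W, ∀ α ∈ S', w α = ∑ i, w (τ i) * g i α := by
    intro w hw α hα
    by_cases hαS : α ∈ S
    · have h1 : (⟨w, hw⟩ : W) = ∑ i, w (τ i) • L (Pi.single i 1) := by
        conv_lhs => rw [← LinearMap.id_apply (R := K) (⟨w, hw⟩ : W), ← hL]
        simp_rw [← map_smul, ← map_sum]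
        rw [LinearMap.comp_apply]
        congr 1
        ext i
        simp [ρ, Finset.sum_apply, Pi.single_apply]
      have h2 := congrFun (congrArg Subtype.val h1) α
      simpa [g, hαS, Finset.sum_apply] using h2
    · obtain ⟨l, -, rfl⟩ := Finset.mem_image.mp ((Finset.mem_union.mp hα).resolve_left hαS)
      simp [g, hαS, hτ.eq_iff]
  set P : MvPolynomial (Fin 2) K := Matrix.det (Matrix.of fun i j => ∑ α ∈ S',
    (monomial (Finsupp.equivFunOnFinite.symm ![α.1, α.2]) (g i α) * C (jet K α j))) with hP
  have hP0 : P ≠ 0 := by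
    suffices h : coeff (∑ i, Finsupp.equivFunOnFinite.symm ![(τ i).1, (τ i).2]) P =
        Matrix.det (Matrix.of fun i => jet K (τ i)) from
      fun h0 => hdet (by rw [← h, h0, coeff_zero])
    rw [hP, coeff_det_jets, Finset.sum_eq_single τ]
    · rw [if_pos rfl, Finset.prod_eq_one, one_mul]
      intro i _
      simp [g, hτS]
    · intro σ hσ hne
      rw [Fintype.mem_piFinset] at hσ
      split_ifs with hsum
      · by_contra h0
        obtain ⟨hprod, hσdet⟩ := mul_ne_zero_iff.mp h0
        have hsum' : ∑ i, σ i = ∑ i, τ i := by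
          have h0 := DFunLike.congr_fun hsum 0
          have h1 := DFunLike.congr_fun hsum 1
          ext
          · simpa [Finsupp.finsetSum_apply, Prod.fst_sum] using h0
          · simpa [Finsupp.finsetSum_apply, Prod.snd_sum] using h1
        have hσS := huniq σ (inj_of_det σ hσdet) hσ hsum'
        refine hne (funext fun i => ?_)
        by_contra hi
        exact Finset.prod_ne_zero_iff.mp hprod i (mem_univ i) (by simp [g, hσS i, hi])
      · rfl
    · intro hτ'
      exact absurd (Fintype.mem_piFinset.mpr fun i =>
        Finset.mem_union_right _ (Finset.mem_image_of_mem _ (mem_univ i))) hτ'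
  obtain ⟨x, y, hx, hy, hxu, hxy⟩ := exists_torus_eval_ne_zero u hP0
  refine ⟨Fin.cons x u, Fin.cons y v,
    Fin.cons_injective_iff.mpr ⟨fun ⟨i, hi⟩ => hxu i hi.symm, hu⟩,
    Fin.cases hx hu0, Fin.cases hy hv0, fun c hc => ?_⟩
  let w : ℕ × ℕ → K := fun α => if α ∈ S' then c α else 0
  have hwc : ∀ α ∈ S', w α = c α := fun α hα => if_pos hα
  have hw : w ∈ W := ⟨fun α hα => if_neg hα, fun i j => by
    rw [Finset.sum_congr rfl fun α hα => by rw [hwc α hα]]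
    simpa using hc i.succ j⟩
  suffices hwτ : (fun i => w (τ i)) = 0 by
    intro α hα
    rw [← hwc α hα, eq_zero w hw fun i => congrFun hwτ i, Pi.zero_apply]
  rw [hP, RingHom.map_det] at hxy
  refine Matrix.eq_zero_of_vecMul_eq_zero hxy (funext fun j => ?_)
  have := hc 0 j
  simp only [Fin.cons_zero] at this
  rw [Pi.zero_apply, ← this, Finset.sum_congr rfl fun α hα => by rw [← hwc α hα, hg w hw α hα]]
  simp only [Matrix.vecMul, dotProduct, RingHom.mapMatrix_apply, Matrix.map_apply, Matrix.of_apply,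
    map_sum, map_mul, eval_monomial, eval_C, Finset.mul_sum, Finset.sum_mul]
  rw [Finset.sum_comm]
  refine Finset.sum_congr rfl fun α _ => Finset.sum_congr rfl fun i _ => ?_
  rw [Finsupp.prod_fintype _ _ (by simp)]
  simp [Fin.prod_univ_two]
  ring

end Interpolates

/-- The exponents `(a, r)` with `a ≤ r < n`, the first `p` exponents of the row `r = n` and the
first `q` exponents of the row `r = n + 1`. -/
def triangleWithRows (n p q : ℕ) : Finset (ℕ × ℕ) :=
  {α ∈ range (n + p + q) ×ˢ range (n + 2) |
    (α.1 ≤ α.2 ∧ α.2 < n) ∨ (α.2 = n ∧ α.1 < p) ∨ (α.2 = n + 1 ∧ α.1 < q)}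

theorem mem_triangleWithRows {n p q : ℕ} {α : ℕ × ℕ} : α ∈ triangleWithRows n p q ↔
    (α.1 ≤ α.2 ∧ α.2 < n) ∨ (α.2 = n ∧ α.1 < p) ∨ (α.2 = n + 1 ∧ α.1 < q) := by
  simp only [triangleWithRows, mem_filter, mem_product, mem_range]
  omega

theorem triangleWithRows_succ (n p : ℕ) :
    triangleWithRows (n + 1) p 0 = triangleWithRows n (n + 1) p := by
  ext α
  simp only [mem_triangleWithRows]
  omega

section Triangle

variable {K : Type*} [Field K] [Infinite K] {n p q k : ℕ}

theorem Interpolates.row_step_two (h : Interpolates K (triangleWithRows n p q) k) :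
    Interpolates K (triangleWithRows n (p + 1) (q + 2)) (k + 1) := by
  have key := h.union_triple ![(p, n), (q, n + 1), (q + 1, n + 1)] ?_ ?_ ?_
  · convert key using 1
    ext ⟨a, r⟩
    simp [mem_triangleWithRows, Fin.exists_fin_succ]
    omega
  · simp [Fin.forall_fin_succ, mem_triangleWithRows]
  · simp [Matrix.det_fin_three, jet]
    ring_nf
    simp
  · intro σ hσ hmem hsum
    have h1 := congrArg Prod.fst hsum
    have h2 := congrArg Prod.snd hsum
    have h01 : σ 0 ≠ σ 1 := hσ.ne (by decide)
    have h02 : σ 0 ≠ σ 2 := hσ.ne (by decide)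
    have h12 : σ 1 ≠ σ 2 := hσ.ne (by decide)
    have hrow : ∀ i, (σ i).2 ≤ n + 1 ∧ ((σ i).2 = n → (σ i).1 ≤ p) ∧
        ((σ i).2 = n + 1 → (σ i).1 ≤ q + 1) := fun i => by
      have := hmem i
      simp [mem_triangleWithRows, Prod.ext_iff, Fin.exists_fin_succ] at this
      omega
    have hr0 := hrow 0
    have hr1 := hrow 1
    have hr2 := hrow 2
    simp only [Fin.sum_univ_three, Prod.fst_add, Prod.snd_add, Matrix.cons_val_zero,
      Matrix.cons_val_one, Matrix.cons_val, ne_eq, Prod.ext_iff, not_and] at h1 h2 h01 h02 h12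
    have hcases : ((σ 0).2 = n ∧ (σ 1).2 = n + 1 ∧ (σ 2).2 = n + 1) ∨
        ((σ 0).2 = n + 1 ∧ (σ 1).2 = n ∧ (σ 2).2 = n + 1) ∨
        ((σ 0).2 = n + 1 ∧ (σ 1).2 = n + 1 ∧ (σ 2).2 = n) := by
      clear hrow h1 h01 h02 h12
      omega
    clear hmem hsum hrow
    simp only [Fin.forall_fin_succ, mem_triangleWithRows]
    rcases hcases with ⟨e0, e1, e2⟩ | ⟨e0, e1, e2⟩ | ⟨e0, e1, e2⟩ <;>
      simp [e0, e1, e2] at * <;> omega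

theorem Interpolates.row_step_one (h : Interpolates K (triangleWithRows n p 0) k) :
    Interpolates K (triangleWithRows n (p + 2) 1) (k + 1) := by
  have key := h.union_triple ![(p, n), (p + 1, n), (0, n + 1)] ?_ ?_ ?_
  · convert key using 1
    ext ⟨a, r⟩
    simp [mem_triangleWithRows, Fin.exists_fin_succ]
    omega
  · simp [Fin.forall_fin_succ, mem_triangleWithRows]
  · simp [Matrix.det_fin_three, jet]
    ring_nf
    simp
  · intro σ hσ hmem hsum
    have h1 := congrArg Prod.fst hsum
    have h2 := congrArg Prod.snd hsum
    have h01 : σ 0 ≠ σ 1 := hσ.ne (by decide)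
    have h02 : σ 0 ≠ σ 2 := hσ.ne (by decide)
    have h12 : σ 1 ≠ σ 2 := hσ.ne (by decide)
    simp [Fin.forall_fin_succ, mem_triangleWithRows, Fin.sum_univ_three, Prod.ext_iff,
      Fin.exists_fin_succ] at *
    omega

theorem Interpolates.row_even (h : Interpolates K (triangleWithRows n p q) k) (j : ℕ) :
    Interpolates K (triangleWithRows n (p + j) (q + 2 * j)) (k + j) := by
  induction j with
  | zero => exact h
  | succ j ih => exact ih.row_step_two

/-- For `k ≠ 2, 5` the first `3 * k` exponents, row by row, can be interpolated at `k` points. -/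
theorem interpolates_triangleWithRows (n m k : ℕ) (hm : m ≤ n + 1)
    (hk : 2 * (3 * k) = n * (n + 1) + 2 * m) (h2 : k ≠ 2) (h5 : k ≠ 5) :
    Interpolates K (triangleWithRows n m 0) k := by
  induction n generalizing m k with
  | zero =>
    obtain ⟨rfl, rfl⟩ : m = 0 ∧ k = 0 := by omega
    exact Interpolates.empty_zero
  | succ n ih =>
    have hbig : 6 ≤ n → 42 ≤ n * (n + 1) := fun h => by nlinarith
    have hsq : (n + 1) * (n + 1 + 1) = n * (n + 1) + 2 * (n + 1) := by ring
    have hsmall : n ≤ 5 → n = 0 ∨ n = 1 ∨ n = 2 ∨ n = 3 ∨ n = 4 ∨ n = 5 := by omega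
    rw [triangleWithRows_succ]
    obtain ⟨j, rfl | rfl⟩ := Nat.even_or_odd' m
    · have hj : j ≤ n + 1 := by omega
      have key := (ih (n + 1 - j) (k - j) (by omega) (by omega) ?_ ?_).row_even j
      · convert key using 2 <;> omega
      all_goals
        by_cases hn : 6 ≤ n
        · have := hbig hn
          omega
        · obtain rfl | rfl | rfl | rfl | rfl | rfl := hsmall (by omega) <;> omega
    · have hj : j + 2 ≤ n + 1 := by
        by_cases hn : 6 ≤ n
        · omega
        · obtain rfl | rfl | rfl | rfl | rfl | rfl := hsmall (by omega) <;> omega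
      have key := (ih (n + 1 - (j + 2)) (k - (j + 1)) (by omega) (by omega) ?_
        ?_).row_step_one.row_even j
      · convert key using 2 <;> omega
      all_goals
        by_cases hn : 6 ≤ n
        · have := hbig hn
          omega
        · obtain rfl | rfl | rfl | rfl | rfl | rfl := hsmall (by omega) <;> omega

end Triangle

theorem card_triangleWithRows (n p q : ℕ) :
    2 * #(triangleWithRows n p q) = n * (n + 1) + 2 * (p + q) := by
  have hrow : ∀ p q, #(triangleWithRows n p q) = #(triangleWithRows n 0 0) + (p + q) := by
    intro p q
    have h1 : triangleWithRows n p q = triangleWithRows n 0 0 ∪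
        (range p ×ˢ {n} ∪ range q ×ˢ {n + 1}) := by
      ext α
      simp only [mem_triangleWithRows, mem_union, mem_product, mem_range, mem_singleton]
      omega
    rw [h1, card_union_of_disjoint, card_union_of_disjoint]
    · simp
    · simp only [Finset.disjoint_left, mem_product, mem_range, mem_singleton]
      omega
    · simp only [Finset.disjoint_left, mem_triangleWithRows, mem_union, mem_product, mem_range,
        mem_singleton]
      omega
  have hbase : 2 * #(triangleWithRows n 0 0) = n * (n + 1) := by
    clear hrow
    induction n with
    | zero => rfl
    | succ n ih =>
      have h1 : triangleWithRows (n + 1) 0 0 = triangleWithRows n 0 0 ∪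
          (range (n + 1) ×ˢ {n}) := by
        ext α
        simp only [mem_triangleWithRows, mem_union, mem_product, mem_range, mem_singleton]
        omega
      rw [h1, card_union_of_disjoint, mul_add, ih]
      · simp
        ring
      · rw [Finset.disjoint_left]
        simp [mem_triangleWithRows]
        omega
  rw [hrow, mul_add, hbase]

theorem card_triangleWithRows_eq_choose (d : ℕ) :
    #(triangleWithRows (d + 1) 0 0) = (d + 2).choose 2 := by
  have h1 := card_triangleWithRows (d + 1) 0 0
  rw [Nat.choose_two_right, Nat.add_sub_cancel (n := d + 1) (m := 1)]
  have h3 : (d + 2) * (d + 1) = (d + 1) * (d + 1 + 1) := by ring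
  omega

theorem exists_eq_triangle_add (t : ℕ) : ∃ n m, m ≤ n ∧ 2 * t = n * (n + 1) + 2 * m := by
  induction t with
  | zero => exact ⟨0, 0, le_rfl, rfl⟩
  | succ t ih =>
    obtain ⟨n, m, hm, h⟩ := ih
    rcases hm.lt_or_eq with hm | rfl
    · exact ⟨n, m + 1, hm, by omega⟩
    · exact ⟨m + 1, 0, Nat.zero_le _, by linarith⟩

/-- For nonexceptional `(d, k)`, a set of exponents of degree at most `d`, of the expected size,
can be interpolated at `k` points. -/
theorem exists_interpolates (K : Type*) [Field K] [Infinite K] {d k : ℕ} (hd : 1 ≤ d)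
    (h2 : ¬(d = 2 ∧ k = 2)) (h5 : ¬(d = 4 ∧ k = 5)) :
    ∃ S ⊆ triangleWithRows (d + 1) 0 0, #S = min (3 * k) ((d + 2).choose 2) ∧
      Interpolates K S k := by
  have hd' := card_triangleWithRows_eq_choose d
  have hcard := card_triangleWithRows (d + 1) 0 0
  have of_subset : ∀ n p q, 2 * (3 * k) = n * (n + 1) + 2 * (p + q) →
      triangleWithRows n p q ⊆ triangleWithRows (d + 1) 0 0 →
      Interpolates K (triangleWithRows n p q) k →
      ∃ S ⊆ triangleWithRows (d + 1) 0 0, #S = min (3 * k) ((d + 2).choose 2) ∧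
        Interpolates K S k := fun n p q hk hS h => by
    refine ⟨_, hS, ?_, h⟩
    have := card_triangleWithRows n p q
    have := card_le_card hS
    omega
  have of_supset : ∀ n p q k', k' ≤ k → 2 * (3 * k') = n * (n + 1) + 2 * (p + q) →
      triangleWithRows (d + 1) 0 0 ⊆ triangleWithRows n p q →
      Interpolates K (triangleWithRows n p q) k' →
      ∃ S ⊆ triangleWithRows (d + 1) 0 0, #S = min (3 * k) ((d + 2).choose 2) ∧
        Interpolates K S k := fun n p q k' hk' hk hS h => by
    refine ⟨_, Subset.rfl, ?_, (h.mono hS).mono_right hk'⟩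
    have := card_triangleWithRows n p q
    have := card_le_card hS
    omega
  have h1 : Interpolates K (triangleWithRows 2 0 0) 1 :=
    interpolates_triangleWithRows 2 0 1 (by omega) (by omega) (by omega) (by omega)
  have h4 : Interpolates K (triangleWithRows 4 2 0) 4 :=
    interpolates_triangleWithRows 4 2 4 (by omega) (by omega) (by omega) (by omega)
  rcases eq_or_ne k 2 with rfl | hk2
  · rcases (show d = 1 ∨ 3 ≤ d by omega) with rfl | hd3
    · exact of_supset 2 0 0 1 (by omega) (by omega) Subset.rfl h1
    · refine of_subset 2 1 2 (by omega) (fun α => ?_) h1.row_step_two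
      simp only [mem_triangleWithRows]
      omega
  rcases eq_or_ne k 5 with rfl | hk5
  · rcases (show d ≤ 3 ∨ 5 ≤ d by omega) with hd3 | hd5
    · refine of_supset 4 2 0 4 (by omega) (by omega) (fun α => ?_) h4
      simp only [mem_triangleWithRows]
      omega
    · refine of_subset 4 3 2 (by omega) (fun α => ?_) h4.row_step_two
      simp only [mem_triangleWithRows]
      omega
  obtain ⟨n, m, hm, hk⟩ := exists_eq_triangle_add (3 * k)
  have h := interpolates_triangleWithRows (K := K) n m k (by omega) hk hk2 hk5
  rcases le_or_gt n d with hn | hn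
  · refine of_subset n m 0 (by omega) (fun α => ?_) h
    simp only [mem_triangleWithRows]
    omega
  · refine of_supset n m 0 k le_rfl (by omega) (fun α => ?_) h
    simp only [mem_triangleWithRows]
    omega

section Codim

variable {K : Type*} [Field K]

instance (d : ℕ) : Module.Finite K (homogeneousSubmodule (Fin 3) K d) :=
  Module.Finite.iff_fg.mpr (homogeneousSubmodule_fg (Fin 3) K d)

theorem finrank_homogeneousSubmodule_fin_three (d : ℕ) :
    Module.finrank K (homogeneousSubmodule (Fin 3) K d) = (d + 2).choose 2 := by
  have hset : {m : Fin 3 →₀ ℕ | m.degree = d} = (univ : Finset (Fin 3)).finsuppAntidiag d := by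
    ext m
    simp [Finsupp.degree_eq_sum]
  rw [homogeneousSubmodule_eq_finsupp_supported, hset,
    (AddMonoidAlgebra.supportedEquivFinsupp _).finrank_eq, Module.finrank_finsupp_self]
  simp only [Finset.coe_sort_coe, Fintype.card_coe]
  rw [card_finsuppAntidiag_nat_eq_choose, card_univ, Fintype.card_fin,
    show 3 + d - 1 = d + 2 by omega, ← Nat.choose_symm_of_eq_add (show d + 2 = d + 2 from rfl)]

theorem codimIn_le_finrank_s18 (d : ℕ) (S : Submodule K (MvPolynomial (Fin 3) K)) :
    codimIn (homogeneousSubmodule (Fin 3) K d) S ≤ (d + 2).choose 2 :=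
  (Submodule.finrank_quotient_le _).trans (finrank_homogeneousSubmodule_fin_three d).le

theorem codimIn_iInf_singularAt_le {d k : ℕ} (p : Fin k → Fin 3 → K) :
    codimIn (homogeneousSubmodule (Fin 3) K d) (⨅ i, singularAt (p i)) ≤ 3 * k := by
  let Φ : homogeneousSubmodule (Fin 3) K d →ₗ[K] (Fin k × Fin 3 → K) :=
    (LinearMap.pi fun x => derivCond (p x.1) x.2) ∘ₗ Submodule.subtype _
  have hker : Submodule.comap (homogeneousSubmodule (Fin 3) K d).subtype
      (⨅ i, singularAt (p i)) = LinearMap.ker Φ := by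
    ext f
    simp [Φ, singularAt, funext_iff]
  rw [codimIn, hker, Φ.quotKerEquivRange.finrank_eq]
  refine (Submodule.finrank_le _).trans ?_
  simp [mul_comm]

/-- If some form of degree `e` vanishes at all the points, its square is singular there. -/
theorem codimIn_lt_of_lt_choose {e k : ℕ} (hk : k < (e + 2).choose 2) (p : Fin k → Fin 3 → K) :
    codimIn (homogeneousSubmodule (Fin 3) K (e + e)) (⨅ i, singularAt (p i)) <
      (e + e + 2).choose 2 := by
  let Φ : homogeneousSubmodule (Fin 3) K e →ₗ[K] (Fin k → K) :=
    (LinearMap.pi fun i => (aeval (p i)).toLinearMap) ∘ₗ Submodule.subtype _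
  have hΦ : LinearMap.ker Φ ≠ ⊥ := LinearMap.ker_ne_bot_of_finrank_lt (by
    rwa [finrank_homogeneousSubmodule_fin_three, Module.finrank_fin_fun])
  obtain ⟨⟨f, hf⟩, hf0, hne⟩ := (Submodule.ne_bot_iff _).mp hΦ
  have hfp : ∀ i, eval (p i) f = 0 := fun i => congrFun hf0 i
  rw [codimIn, ← finrank_homogeneousSubmodule_fin_three (K := K) (e + e),
    ← Submodule.finrank_quotient_add_finrank
      (Submodule.comap (homogeneousSubmodule (Fin 3) K (e + e)).subtype (⨅ i, singularAt (p i)))]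
  refine Nat.lt_add_of_pos_right
    (Submodule.one_le_finrank_iff.mpr ((Submodule.ne_bot_iff _).mpr ?_))
  refine ⟨⟨f * f, IsHomogeneous.mul hf hf⟩, ?_, fun h => ?_⟩
  · simp [singularAt, derivCond, hfp]
  · exact hne (Subtype.ext (mul_self_eq_zero.mp (congrArg Subtype.val h)))

/-- The exponent of the monomial `x ^ a * y ^ (r - a) * z ^ (d - r)`. -/
def formExponent (d : ℕ) (α : ℕ × ℕ) : Fin 3 →₀ ℕ :=
  Finsupp.equivFunOnFinite.symm ![α.1, α.2 - α.1, d - α.2]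

theorem mul_derivCond_monomial_formExponent {d : ℕ} {α : ℕ × ℕ}
    (hα : α ∈ triangleWithRows (d + 1) 0 0) (x y c : K) (i : Fin 3) :
    ![x * y, y, 1] i * derivCond ![x * y, y, 1] i (monomial (formExponent d α) c) =
      formExponent d α i * (c * (x ^ α.1 * y ^ α.2)) := by
  have h : aeval ![x * y, y, 1] (X i * pderiv i (monomial (formExponent d α) c)) =
      ![x * y, y, 1] i * derivCond ![x * y, y, 1] i (monomial (formExponent d α) c) := by
    rw [map_mul, aeval_X]
    rfl
  rw [← h, X_mul_pderiv_monomial, map_nsmul, nsmul_eq_mul, aeval_monomial,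
    Finsupp.prod_fintype _ _ (by simp)]
  obtain ⟨a, r⟩ := α
  have har : a ≤ r := by
    simp only [mem_triangleWithRows] at hα
    omega
  obtain ⟨b, rfl⟩ := Nat.exists_eq_add_of_le har
  simp [Fin.prod_univ_three, formExponent]
  left
  left
  ring

/-- Sets of exponents that can be interpolated give lower bounds for the codimension of
the forms that are singular at suitable points. -/
theorem Interpolates.exists_le_codimIn [CharZero K] {S : Finset (ℕ × ℕ)} {d k : ℕ} (hd : 1 ≤ d)
    (h : Interpolates K S k) (hS : S ⊆ triangleWithRows (d + 1) 0 0) :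
    ∃ p : Fin k → (Fin 3 → K), (∀ i, p i ≠ 0) ∧
      (∀ i j, i ≠ j → ∀ c : K, p j ≠ c • p i) ∧
      #S ≤ codimIn (homogeneousSubmodule (Fin 3) K d) (⨅ i, singularAt (p i)) := by
  obtain ⟨u, v, hu, hu0, hv0, H⟩ := h
  refine ⟨fun i => ![u i * v i, v i, 1], fun i hi => ?_, fun i j hij c hc => ?_, ?_⟩
  · simpa using congrFun hi 2
  · have hc0 := congrFun hc 0
    have hc1 := congrFun hc 1
    have hc2 := congrFun hc 2
    simp at hc0 hc1 hc2
    subst hc2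
    rw [hc1, one_mul, one_mul] at hc0
    exact hij (hu (mul_right_cancel₀ (hv0 i) hc0)).symm
  set p : Fin k → (Fin 3 → K) := fun i => ![u i * v i, v i, 1] with hp
  let ψ : (S → K) →ₗ[K] MvPolynomial (Fin 3) K :=
    ∑ α : S, monomial (formExponent d α) ∘ₗ LinearMap.proj α
  have hψ : ∀ c, ψ c = ∑ α : S, monomial (formExponent d α) (c α) := fun c => by simp [ψ]
  have hhom : ∀ c, ψ c ∈ homogeneousSubmodule (Fin 3) K d := fun c => by
    rw [hψ]
    refine Submodule.sum_mem _ fun α _ => isHomogeneous_monomial _ ?_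
    have := mem_triangleWithRows.mp (hS α.2)
    simp [formExponent, Finsupp.degree_eq_sum, Fin.sum_univ_three]
    omega
  have hinj : ∀ c, ψ c ∈ ⨅ i, singularAt (p i) → c = 0 := by
    intro c hc
    let c' : ℕ × ℕ → K := fun α => if hα : α ∈ S then c ⟨α, hα⟩ else 0
    have hcc : ∀ α : S, c α = c' α := fun α => by simp [c']
    have hsum : ∀ i j, ∑ α ∈ S, (formExponent d α j : K) * (c' α * (u i ^ α.1 * v i ^ α.2)) =
        0 := by
      intro i j
      have h0 : derivCond (p i) j (ψ c) = 0 := by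
        simp only [singularAt, Submodule.mem_iInf, LinearMap.mem_ker] at hc
        exact hc i j
      rw [hψ, map_sum] at h0
      have h1 := congrArg (fun t => p i j * t) h0
      simp only [Finset.mul_sum, mul_zero] at h1
      rw [← h1, ← Finset.sum_coe_sort]
      refine Finset.sum_congr rfl fun α _ => ?_
      rw [← hcc, hp, mul_derivCond_monomial_formExponent (hS α.2)]
    have hc' := H c' fun i j => ?_
    · ext α
      rw [hcc, hc' α α.2, Pi.zero_apply]
    · have e0 := hsum i 0
      have e1 := hsum i 1
      have e2 := hsum i 2
      have hr : ∑ α ∈ S, c' α * (u i ^ α.1 * v i ^ α.2 * α.2) = 0 := by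
        rw [← add_zero (0 : K)]
        nth_rewrite 2 [← e0]
        rw [← e1, ← Finset.sum_add_distrib]
        refine Finset.sum_congr rfl fun α hα => ?_
        have := mem_triangleWithRows.mp (hS hα)
        simp [formExponent]
        rw [Nat.cast_sub (by omega)]
        ring
      fin_cases j
      · have hd0 : (d : K) ≠ 0 := Nat.cast_ne_zero.mpr (by omega)
        refine mul_left_cancel₀ hd0 ?_
        rw [mul_zero, ← add_zero (0 : K)]
        nth_rewrite 1 [← e2]
        rw [← hr, ← Finset.sum_add_distrib, Finset.mul_sum]
        refine Finset.sum_congr rfl fun α hα => ?_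
        have := mem_triangleWithRows.mp (hS hα)
        simp [formExponent, jet]
        rw [Nat.cast_sub (by omega)]
        ring
      · rw [← e0]
        refine Finset.sum_congr rfl fun α _ => ?_
        simp [formExponent, jet]
        ring
      · simpa [jet] using hr
  let Ψ := Submodule.mkQ (Submodule.comap (homogeneousSubmodule (Fin 3) K d).subtype
    (⨅ i, singularAt (p i))) ∘ₗ ψ.codRestrict _ hhom
  have hΨ : Function.Injective Ψ := LinearMap.ker_eq_bot.mp <| LinearMap.ker_eq_bot'.mpr
    fun c hc => hinj c <| by
      have := (Submodule.Quotient.mk_eq_zero _).mp hc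
      exact this
  have := LinearMap.finrank_le_finrank_of_injective hΨ
  rwa [Module.finrank_fintype_fun_eq_card, Fintype.card_coe] at this

end Codim

end DoublePoints

/-- The Alexander–Hirschowitz theorem for `P^2` (Campbell, Palatini, Terracini):
a general union of `k` double points in `P^2` imposes independent conditions on plane
curves of degree `d` — i.e. there exist `k` (nonzero, pairwise non-proportional)
points such that the degree-`d` forms singular at all of them form a subspace of
codimension `min(3k, C(d+2,2))` — except exactly when `(d,k) = (2,2)` or `(4,5)`. -/
theorem stmt_18 (K : Type*) [Field K] [IsAlgClosed K] [CharZero K] (d k : ℕ) (hd : 1 ≤ d) :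
    (∃ p : Fin k → (Fin 3 → K), (∀ i, p i ≠ 0) ∧
        (∀ i j, i ≠ j → ∀ c : K, p j ≠ c • p i) ∧
        codimIn (homogeneousSubmodule (Fin 3) K d) (⨅ i, singularAt (p i)) =
          min (3 * k) ((d + 2).choose 2)) ↔
      ¬(d = 2 ∧ k = 2) ∧ ¬(d = 4 ∧ k = 5) := by
  constructor
  · rintro ⟨p, -, -, hp⟩
    constructor
    · rintro ⟨rfl, rfl⟩
      exact (codimIn_lt_of_lt_choose (e := 1) (by decide) p).ne hp
    · rintro ⟨rfl, rfl⟩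
      exact (codimIn_lt_of_lt_choose (e := 2) (by decide) p).ne hp
  · rintro ⟨h2, h5⟩
    obtain ⟨S, hS, hcard, h⟩ := exists_interpolates K hd h2 h5
    obtain ⟨p, hp0, hpp, hp⟩ := h.exists_le_codimIn hd hS
    exact ⟨p, hp0, hpp, le_antisymm
      (le_min (codimIn_iInf_singularAt_le p) (codimIn_le_finrank_s18 d _)) (hcard ▸ hp)⟩

end
end
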